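/- arXiv:2212.05139 — 9 statements merged into one kernel-verified Lean document; each statement's English description precedes it below -/
import Mathlib

section
/- Let γ > 0, β ≥ 0, α ≥ 0, T > 0 satisfy the stability condition γ/2 + β + Tα > 1/T. Then for every θ ∈ ℝ, every complex root λ of the characteristic equation λ² + γ((1 − e^{iθ})/T + λ) + βλ(1 − e^{iθ}) + α(2 − e^{iθ} − e^{−iθ}) = 0 satisfies Re(λ) ≤ 0. -/
open Complex Real

/-- A Routh–Hurwitz criterion for the complex quadratic `z² + (a + b i) z + (c + d i)`, with
`z = x + y i` and the equation split into real and imaginary parts. -/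
lemma re_nonpos_of_quadratic {a b c d x y : ℝ} (ha : 0 < a) (hc : 0 ≤ c)
    (h : 0 ≤ a ^ 2 * c + a * b * d - d ^ 2)
    (hre : x ^ 2 - y ^ 2 + a * x - b * y + c = 0)
    (him : 2 * x * y + a * y + b * x + d = 0) : x ≤ 0 := by
  by_contra! hx
  have key : a ^ 2 * x ^ 2 + (4 * a * x + 4 * x ^ 2) * x ^ 2 + (a * x) * (2 * x + a) ^ 2
      + c * (4 * a * x + 4 * x ^ 2) + b ^ 2 * x ^ 2 + a * b ^ 2 * x
      + (a ^ 2 * c + a * b * d - d ^ 2) = 0 := by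
    linear_combination (2 * x + a) ^ 2 * hre
      + (y * (2 * x + a) - (b * x + d) + b * (2 * x + a)) * him
  have : 0 < a ^ 2 * x ^ 2 + (4 * a * x + 4 * x ^ 2) * x ^ 2 + (a * x) * (2 * x + a) ^ 2
      + c * (4 * a * x + 4 * x ^ 2) + b ^ 2 * x ^ 2 + a * b ^ 2 * x := by
    positivity
  linarith

/-- The Routh–Hurwitz discriminant of the characteristic equation is nonnegative; here `t = 1 / T`,
`u = 1 - cos θ` and `s = sin θ`. -/
lemma discriminant_nonneg {γ β α t u s : ℝ} (hγ : 0 < γ) (hβ : 0 ≤ β) (hα : 0 ≤ α) (ht : 0 < t)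
    (hstab : t ^ 2 < t * γ / 2 + t * β + α) (hu : 0 ≤ u) (hu2 : u ≤ 2)
    (hs : s ^ 2 = u * (2 - u)) :
    0 ≤ (γ + β * u) ^ 2 * (γ * t * u + 2 * α * u)
      + (γ + β * u) * (-(β * s)) * (-(γ * t * s)) - (-(γ * t * s)) ^ 2 := by
  have hfactor : (γ + β * u) ^ 2 * (γ * t * u + 2 * α * u)
      + (γ + β * u) * (-(β * s)) * (-(γ * t * s)) - (-(γ * t * s)) ^ 2
      = u * (2 * γ ^ 2 * (t * γ / 2 + t * β + α - t ^ 2)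
        + (2 * γ * β * u + β ^ 2 * u ^ 2) * (γ * t + 2 * α)
        + (2 - u) * (β ^ 2 * u * γ * t) + u * (γ ^ 2 * t * (t - β))) := by
    linear_combination ((γ + β * u) * β * γ * t - γ ^ 2 * t ^ 2) * hs
  rw [hfactor]
  have h2u : 0 ≤ 2 - u := by linarith
  have hgap : 0 ≤ t * γ / 2 + t * β + α - t ^ 2 := by linarith
  refine mul_nonneg hu ?_
  rcases le_total β t with h | h
  · have : 0 ≤ t - β := by linarith
    positivity
  · have hβt : 0 ≤ β - t := by linarith
    have hsum : 0 ≤ γ ^ 2 * (t * γ + 2 * α) + (2 - u) * (γ ^ 2 * t * (β - t))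
        + (2 * γ * β * u + β ^ 2 * u ^ 2) * (γ * t + 2 * α)
        + (2 - u) * (β ^ 2 * u * γ * t) := by positivity
    linarith

/-- under the stability condition `γ/2 + β + Tα > 1/T`, every root
of the characteristic equation has non-positive real part, for every θ. -/
theorem statement2 (γ β α T : ℝ) (hγ : 0 < γ) (hβ : 0 ≤ β) (hα : 0 ≤ α) (hT : 0 < T)
    (hstab : γ / 2 + β + T * α > 1 / T) :
    ∀ θ : ℝ, ∀ lam : ℂ,
      lam ^ 2 + (γ : ℂ) * ((1 - Complex.exp (θ * Complex.I)) / (T : ℂ) + lam)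
        + (β : ℂ) * lam * (1 - Complex.exp (θ * Complex.I))
        + (α : ℂ) * (2 - Complex.exp (θ * Complex.I) - Complex.exp (-(θ * Complex.I))) = 0 →
      lam.re ≤ 0 := by
  intro θ lam h
  have hexp : Complex.exp (θ * Complex.I) = ⟨Real.cos θ, Real.sin θ⟩ := by
    apply Complex.ext
    · exact Complex.exp_ofReal_mul_I_re θ
    · exact Complex.exp_ofReal_mul_I_im θ
  have hexp_neg : Complex.exp (-(θ * Complex.I)) = ⟨Real.cos θ, -Real.sin θ⟩ := by
    rw [← neg_mul, ← Complex.ofReal_neg]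
    apply Complex.ext
    · rw [Complex.exp_ofReal_mul_I_re, Real.cos_neg]
    · rw [Complex.exp_ofReal_mul_I_im, Real.sin_neg]
  rw [hexp, hexp_neg, div_eq_mul_inv, ← Complex.ofReal_inv] at h
  have hu : 0 ≤ 1 - Real.cos θ := by linarith [Real.cos_le_one θ]
  have hu2 : 1 - Real.cos θ ≤ 2 := by linarith [Real.neg_one_le_cos θ]
  have hs : Real.sin θ ^ 2 = (1 - Real.cos θ) * (2 - (1 - Real.cos θ)) := by
    linear_combination Real.sin_sq_add_cos_sq θ
  have ht : 0 < T⁻¹ := inv_pos.mpr hT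
  have hstab' : T⁻¹ ^ 2 < T⁻¹ * γ / 2 + T⁻¹ * β + α := by
    have hmul := mul_lt_mul_of_pos_left hstab ht
    have hTT : T⁻¹ * T = 1 := inv_mul_cancel₀ hT.ne'
    rw [one_div] at hmul
    linear_combination hmul + α * hTT
  have hre := congrArg Complex.re h
  have him := congrArg Complex.im h
  simp [pow_two] at hre him
  refine re_nonpos_of_quadratic (y := lam.im) ?_ ?_
    (discriminant_nonneg hγ hβ hα ht hstab' hu hu2 hs) ?_ ?_
  · positivity
  · positivity
  · linear_combination hre
  · linear_combination him
end

section
/- Let γ > 0, β ≥ 0, α ≥ 0, T > 0 satisfy the stability condition γ/2 + β + Tα > 1/T. Then for every θ ∈ (0, 2π), every complex root λ of the characteristic equation λ² + γ((1 − e^{iθ})/T + λ) + βλ(1 − e^{iθ}) + α(2 − e^{iθ} − e^{−iθ}) = 0 satisfies Re(λ) < 0 strictly. -/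
open Complex Real

/-- A root of a monic complex quadratic `z² + (p + iq)z + (m + in)` lies in the open left
half-plane under the Hurwitz conditions. -/
theorem neg_of_complex_hurwitz {p q m n x y : ℝ} (hp : 0 < p) (hm : 0 ≤ m)
    (hdet : 0 < p ^ 2 * m + p * q * n - n ^ 2)
    (hre : x ^ 2 - y ^ 2 + p * x - q * y + m = 0)
    (him : 2 * x * y + p * y + q * x + n = 0) : x < 0 := by
  by_contra! hx
  have key : (p ^ 2 * m + p * q * n - n ^ 2) + x * (p ^ 3 + 4 * p * m + q ^ 2 * p)
      + x ^ 2 * (5 * p ^ 2 + 4 * m + q ^ 2) + x ^ 3 * (8 * p) + 4 * x ^ 4 = 0 := by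
    linear_combination (2 * x + p) ^ 2 * hre
      + ((2 * x + p) * y - (q * x + n) + q * (2 * x + p)) * him
  have : 0 ≤ x * (p ^ 3 + 4 * p * m + q ^ 2 * p) + x ^ 2 * (5 * p ^ 2 + 4 * m + q ^ 2)
      + x ^ 3 * (8 * p) + 4 * x ^ 4 := by positivity
  linarith

/-- Positivity of the Hurwitz determinant, with `τ = 1 / T` and `(c, s)` on the unit circle. -/
theorem hurwitz_det_pos {γ β α τ c s : ℝ} (hγ : 0 < γ) (hβ : 0 ≤ β) (hα : 0 ≤ α)
    (hτ : 0 < τ) (hstab : 0 < (γ / 2 + β - τ) * τ + α) (hcs : s ^ 2 + c ^ 2 = 1)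
    (hc : c < 1) :
    0 < (γ + β * (1 - c)) ^ 2 * ((1 - c) * (γ * τ + 2 * α))
      + (γ + β * (1 - c)) * (-(β * s)) * (-(γ * τ * s)) - (-(γ * τ * s)) ^ 2 := by
  have hu : 0 < 1 - c := by linarith
  have hv : 0 ≤ 1 + c := by nlinarith [sq_nonneg s]
  have hcoef : 0 < γ * τ + 2 * α + (1 + c) * τ * (β - τ) := by
    rcases le_total τ β with h | h
    · have := mul_nonneg (mul_nonneg hv hτ.le) (sub_nonneg.2 h)
      have := mul_pos hγ hτ
      linarith
    · have := mul_nonneg (mul_nonneg hu.le hτ.le) (sub_nonneg.2 h)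
      linarith
  have hrest : 0 ≤ (2 * γ * β * (1 - c) + β ^ 2 * (1 - c) ^ 2) * (γ * τ + 2 * α)
      + (1 + c) * γ * τ * β ^ 2 * (1 - c) := by positivity
  have hpos : 0 < (1 - c) * (γ ^ 2 * (γ * τ + 2 * α + (1 + c) * τ * (β - τ))
      + ((2 * γ * β * (1 - c) + β ^ 2 * (1 - c) ^ 2) * (γ * τ + 2 * α)
      + (1 + c) * γ * τ * β ^ 2 * (1 - c))) := by positivity
  have hs : s ^ 2 = 1 - c ^ 2 := by linarith
  convert hpos using 1
  linear_combination ((γ + β * (1 - c)) * β * γ * τ - γ ^ 2 * τ ^ 2) * hs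

/-- under the stability condition `γ/2 + β + Tα > 1/T`, for every
θ ∈ (0, 2π) every root of the characteristic equation has strictly negative
real part. -/
theorem statement3 (γ β α T : ℝ) (hγ : 0 < γ) (hβ : 0 ≤ β) (hα : 0 ≤ α) (hT : 0 < T)
    (hstab : γ / 2 + β + T * α > 1 / T) :
    ∀ θ ∈ Set.Ioo (0 : ℝ) (2 * Real.pi), ∀ lam : ℂ,
      lam ^ 2 + (γ : ℂ) * ((1 - Complex.exp (θ * Complex.I)) / (T : ℂ) + lam)
        + (β : ℂ) * lam * (1 - Complex.exp (θ * Complex.I))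
        + (α : ℂ) * (2 - Complex.exp (θ * Complex.I) - Complex.exp (-(θ * Complex.I))) = 0 →
      lam.re < 0 := by
  rintro θ ⟨h0, h2π⟩ lam h
  have hc : Real.cos θ < 1 := by
    refine lt_of_le_of_ne (Real.cos_le_one θ) fun hcos => h0.ne' ?_
    exact (Real.cos_eq_one_iff_of_lt_of_lt (by linarith) h2π).1 hcos
  have hτ : 0 < T⁻¹ := inv_pos.2 hT
  have hstab' : 0 < (γ / 2 + β - T⁻¹) * T⁻¹ + α := by
    rw [one_div] at hstab
    have hpos := mul_pos (sub_pos.2 hstab) hτ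
    have hTT : T * T⁻¹ = 1 := mul_inv_cancel₀ hT.ne'
    linear_combination hpos + α * hTT
  have hdet := hurwitz_det_pos hγ hβ hα hτ hstab' (Real.sin_sq_add_cos_sq θ) hc
  have hu : 0 < 1 - Real.cos θ := by linarith
  have hneg : Complex.exp (-(θ * Complex.I)) = Real.cos θ - Real.sin θ * Complex.I := by
    rw [← neg_mul, Complex.exp_mul_I, Complex.cos_neg, Complex.sin_neg]
    push_cast
    ring
  rw [hneg, Complex.exp_mul_I, ← Complex.ofReal_cos, ← Complex.ofReal_sin, div_eq_mul_inv,
    ← Complex.ofReal_inv] at h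
  have hre := congrArg Complex.re h
  have him := congrArg Complex.im h
  simp only [pow_two, Complex.add_re, Complex.add_im, Complex.sub_re, Complex.sub_im,
    Complex.mul_re, Complex.mul_im, Complex.ofReal_re, Complex.ofReal_im, Complex.I_re,
    Complex.I_im, Complex.one_re, Complex.one_im, Complex.re_ofNat, Complex.im_ofNat,
    Complex.zero_re, Complex.zero_im] at hre him
  refine neg_of_complex_hurwitz (y := lam.im) (by positivity) (by positivity) hdet ?_ ?_
  · linear_combination hre
  · linear_combination him
end

section
/- Let N > 2 and γ > 0, β ≥ 0, α ≥ 0, T > 0 satisfy the stability condition γ/2 + β + Tα > 1/T, and let A ∈ ℝ^{2N×2N} be the coefficient matrix of the linearised periodic car-following system. If A is diagonalisable, then every (complex) eigenvalue λ of A satisfies Re(λ) ≤ 0. -/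
open Matrix Complex

/-- A root of a monic complex quadratic `z² + (a + ib) z + (p + iq)` satisfying the
Routh–Hurwitz inequality lies in the closed left half-plane. -/
theorem re_nonpos_of_quadratic_root {z : ℂ} {a b p q : ℝ} (ha : 0 < a) (hp : 0 ≤ p)
    (hstable : 0 ≤ a ^ 2 * p + a * b * q - q ^ 2)
    (hre : z.re ^ 2 - z.im ^ 2 + a * z.re - b * z.im + p = 0)
    (him : 2 * z.re * z.im + a * z.im + b * z.re + q = 0) : z.re ≤ 0 := by
  by_contra! hx
  generalize z.re = x at *
  generalize z.im = y at *
  have key : (2 * x + a) ^ 2 * (x ^ 2 + a * x + p) + b ^ 2 * (x * (x + a))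
      = q ^ 2 - a * b * q := by
    linear_combination (2 * x + a) ^ 2 * hre
      + ((2 * x + a) * y - (b * x + q) + b * (2 * x + a)) * him
  have h₁ : 0 < (2 * x + a) ^ 2 * (x ^ 2 + a * x) := by positivity
  have h₂ : 0 ≤ (4 * x ^ 2 + 4 * x * a) * p := by positivity
  have h₃ : 0 ≤ b ^ 2 * (x * (x + a)) := by positivity
  linarith

/-- A nonzero `N`-periodic solution of a three-term recurrence with constant coefficients
forces the characteristic equation to have a root on the unit circle. -/
theorem exists_norm_eq_one_of_periodic_recurrence {N : ℕ} [NeZero N] {p q r : ℂ}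
    {x : Fin N → ℂ} (hx : x ≠ 0)
    (h : ∀ n, p * x n + q * x (n + 1) + r * x (n - 1) = 0) :
    ∃ w : ℂ, ‖w‖ = 1 ∧ p + q * w + r * w⁻¹ = 0 := by
  let S : Module.End ℂ (Fin N → ℂ) := LinearMap.funLeft ℂ ℂ (· + 1)
  let W : Submodule ℂ (Fin N → ℂ) :=
    { carrier := {u | ∀ n, p * u n + q * u (n + 1) + r * u (n - 1) = 0}
      add_mem' := fun {u v} hu hv n => by
        simp only [Pi.add_apply]
        linear_combination hu n + hv n
      zero_mem' := fun n => by simp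
      smul_mem' := fun c u hu n => by
        simp only [Pi.smul_apply, smul_eq_mul]
        linear_combination c * hu n }
  have hSW : ∀ u ∈ W, S u ∈ W := fun u hu n => by
    have := hu (n + 1)
    simpa [S, LinearMap.funLeft_apply] using this
  have : Nontrivial W := ⟨⟨x, h⟩, 0, fun e => hx (congrArg Subtype.val e)⟩
  obtain ⟨w, hw⟩ := Module.End.exists_eigenvalue (S.restrict hSW)
  obtain ⟨⟨u, hu⟩, huw⟩ := hw.exists_hasEigenvector
  have hu₀ : u ≠ 0 := fun e => huw.2 (Subtype.ext e)
  have hshift : ∀ n, u (n + 1) = w * u n := fun n =>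
    congrFun (congrArg Subtype.val huw.apply_eq_smul) n
  obtain ⟨m, hm⟩ := Function.ne_iff.mp hu₀
  have hsum : 0 < ∑ n, ‖u n‖ :=
    Finset.sum_pos' (fun _ _ => norm_nonneg _) ⟨m, Finset.mem_univ m, norm_pos_iff.mpr hm⟩
  have hw₁ : ‖w‖ = 1 := by
    have e : ∑ n, ‖u (n + 1)‖ = ∑ n, ‖u n‖ :=
      Equiv.sum_comp (Equiv.addRight (1 : Fin N)) fun n => ‖u n‖
    simp only [hshift, norm_mul, ← Finset.mul_sum] at e
    exact (mul_eq_right₀ hsum.ne').mp e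
  have hw₀ : w ≠ 0 := norm_ne_zero_iff.mp (by simp [hw₁])
  refine ⟨w, hw₁, ?_⟩
  have hprev : u (m - 1) = w⁻¹ * u m := by
    have := hshift (m - 1)
    rw [sub_add_cancel] at this
    rw [this, inv_mul_cancel_left₀ hw₀]
  have hmul := hu m
  rw [hshift, hprev] at hmul
  refine (mul_eq_zero.mp ?_).resolve_right hm
  linear_combination hmul

/-- The Routh–Hurwitz inequality of the car-following dispersion relation at wave number `θ`,
where `c = cos θ` and `s = sin θ`. -/
theorem dispersion_stable {γ β α T c s : ℝ} (hγ : 0 < γ) (hβ : 0 ≤ β) (hα : 0 ≤ α)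
    (hT : 0 < T) (hstab : γ / 2 + β + T * α > 1 / T) (hcs : c ^ 2 + s ^ 2 = 1) (hc : c ≤ 1) :
    0 ≤ (γ + β * (1 - c)) ^ 2 * ((γ / T + 2 * α) * (1 - c))
      + (γ + β * (1 - c)) * (-(β * s)) * (-(γ / T * s)) - (-(γ / T * s)) ^ 2 := by
  obtain ⟨τ, hτ, rfl⟩ : ∃ τ : ℝ, 0 < τ ∧ T = τ⁻¹ := ⟨T⁻¹, inv_pos.mpr hT, (inv_inv T).symm⟩
  obtain ⟨k, hk, hkα⟩ : ∃ k : ℝ, 0 ≤ k ∧ α = τ * k :=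
    ⟨τ⁻¹ * α, by positivity, by field_simp⟩
  subst hkα
  rw [one_div, inv_inv, inv_mul_cancel_left₀ hτ.ne'] at hstab
  rw [div_inv_eq_mul]
  obtain ⟨u, hu, rfl⟩ : ∃ u : ℝ, 0 ≤ u ∧ c = 1 - u := ⟨1 - c, by linarith, by ring⟩
  have hs : s ^ 2 = u * (2 - u) := by linear_combination hcs
  have h₀ : 0 ≤ 2 * γ ^ 2 * τ * (γ / 2 + β + k - τ) :=
    mul_nonneg (by positivity) (by linarith)
  have h₁ : 0 ≤ β * γ ^ 2 * τ + 4 * (τ * k) * β * γ + 2 * β ^ 2 * γ * τ + γ ^ 2 * τ ^ 2 := by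
    positivity
  have h₂ : 0 ≤ 2 * (τ * k) * β ^ 2 := by positivity
  have hpos := mul_nonneg hu (add_nonneg h₀
    (add_nonneg (mul_nonneg hu h₁) (mul_nonneg (sq_nonneg u) h₂)))
  refine hpos.trans_eq ?_
  linear_combination (-((γ + β * u) * β * γ * τ) + γ ^ 2 * τ ^ 2) * hs

/-- if the stability condition `γ/2 + β + Tα > 1/T` holds and the
coefficient matrix `A` of the linearised periodic car-following system is
diagonalisable, then every complex eigenvalue of `A` has non-positive real
part.  The state is indexed by `Fin N × Fin 2`, where `(n, 0)` is `xₙ` and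
`(n, 1)` is `yₙ`; `A` is characterised by its action on vectors. -/
theorem statement4 (N : ℕ) [NeZero N] (hN : 2 < N) (γ β α T : ℝ)
    (hγ : 0 < γ) (hβ : 0 ≤ β) (hα : 0 ≤ α) (hT : 0 < T)
    (hstab : γ / 2 + β + T * α > 1 / T)
    (A : Matrix (Fin N × Fin 2) (Fin N × Fin 2) ℝ)
    (hA : ∀ (z : Fin N × Fin 2 → ℝ) (n : Fin N),
      A.mulVec z (n, 0) = z (n, 1) ∧
      A.mulVec z (n, 1)
        = γ * ((z (n + 1, 0) - z (n, 0)) / T - z (n, 1))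
          + β * (z (n + 1, 1) - z (n, 1))
          + α * (z (n + 1, 0) - 2 * z (n, 0) + z (n - 1, 0)))
    -- A is diagonalisable (over ℂ):
    (hdiag : ∃ P : Matrix (Fin N × Fin 2) (Fin N × Fin 2) ℂ,
      IsUnit P.det ∧ (P⁻¹ * A.map (fun x : ℝ => (x : ℂ)) * P).IsDiag) :
    ∀ (lam : ℂ) (v : Fin N × Fin 2 → ℂ), v ≠ 0 →
      (A.map (fun x : ℝ => (x : ℂ))).mulVec v = lam • v → lam.re ≤ 0 := by
  intro lam v hv hlam
  have hre : ∀ i, (lam * v i).re = A.mulVec (fun j => (v j).re) i := fun i => by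
    rw [← smul_eq_mul, ← Pi.smul_apply, ← hlam]
    simp [Matrix.mulVec, dotProduct]
  have him : ∀ i, (lam * v i).im = A.mulVec (fun j => (v j).im) i := fun i => by
    rw [← smul_eq_mul, ← Pi.smul_apply, ← hlam]
    simp [Matrix.mulVec, dotProduct]
  have hy : ∀ n, v (n, 1) = lam * v (n, 0) := fun n =>
    Complex.ext ((hre _).trans (hA _ n).1).symm ((him _).trans (hA _ n).1).symm
  have hacc : ∀ n, lam * v (n, 1) = (γ * T⁻¹ : ℝ) * (v (n + 1, 0) - v (n, 0)) - γ * v (n, 1)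
      + β * (v (n + 1, 1) - v (n, 1))
      + α * (v (n + 1, 0) - 2 * v (n, 0) + v (n - 1, 0)) := fun n => by
    apply Complex.ext
    · rw [hre, (hA _ n).2]
      simp only [sub_re, re_ofReal_mul, two_mul, add_re]
      ring
    · rw [him, (hA _ n).2]
      simp only [sub_im, im_ofReal_mul, two_mul, add_im]
      ring
  have hx : (fun n => v (n, 0)) ≠ 0 := fun e => hv <| by
    have e₀ : ∀ n, v (n, 0) = 0 := congrFun e
    ext ⟨n, i⟩
    fin_cases i
    · exact e₀ n
    · exact (hy n).trans (by simp [e₀ n])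
  obtain ⟨w, hw, hchar⟩ := exists_norm_eq_one_of_periodic_recurrence
    (p := lam ^ 2 + γ * lam + (γ * T⁻¹ : ℝ) + β * lam + 2 * α)
    (q := -((γ * T⁻¹ : ℝ) + β * lam + α)) (r := -α) hx (fun n => by
      have h := hacc n
      rw [hy, hy] at h
      linear_combination h)
  have hcs : w.re ^ 2 + w.im ^ 2 = 1 := by
    have := Complex.sq_norm w
    rw [hw, Complex.normSq_apply] at this
    linarith
  have hc : w.re ≤ 1 := hw ▸ Complex.re_le_norm w
  rw [Complex.inv_eq_conj hw] at hchar
  have hR := congrArg Complex.re hchar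
  have hI := congrArg Complex.im hchar
  simp [pow_two] at hR hI
  have hu : 0 ≤ 1 - w.re := by linarith
  refine re_nonpos_of_quadratic_root (by positivity) (by positivity)
    (dispersion_stable hγ hβ hα hT hstab hcs hc) ?_ ?_
  · rw [div_eq_mul_inv]
    linear_combination hR
  · rw [div_eq_mul_inv]
    linear_combination hI
end

section
/- Let N > 2, γ > 0, β ≥ 0, α ≥ 0, T > 0, let A ∈ ℝ^{2N×2N} be the coefficient matrix of the linearised periodic car-following system, and let ω = e^{2πi/N}. Then the characteristic polynomial of A factorises over ℂ as det(λI − A) = ∏_{k=0}^{N−1} [λ² + γ((1 − ω^k)/T + λ) + βλ(1 − ω^k) + α(2 − ω^k − ω^{−k})]. In particular, λ ∈ ℂ is an eigenvalue of A if and only if there exists k ∈ {0,…,N−1} such that λ solves the characteristic equation with θ = 2πk/N. -/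
open Matrix Complex Finset

/-- A real matrix acts on a complex vector separately on its real and imaginary parts. -/
theorem re_im_map_ofReal_mulVec {ι : Type*} [Fintype ι] (A : Matrix ι ι ℝ) (z : ι → ℂ) (i : ι) :
    ((A.map (fun x : ℝ => (x : ℂ))).mulVec z i).re = A.mulVec (fun j => (z j).re) i ∧
    ((A.map (fun x : ℝ => (x : ℂ))).mulVec z i).im = A.mulVec (fun j => (z j).im) i := by
  simp [Matrix.mulVec, dotProduct]

theorem pow_val_add_one {M : Type*} [Monoid M] {N : ℕ} [NeZero N] {ω : M} (h : ω ^ N = 1)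
    (n : Fin N) : ω ^ ((n + 1 : Fin N) : ℕ) = ω ^ (n : ℕ) * ω := by
  rw [Fin.val_add, ← pow_eq_pow_mod _ h, pow_add, Fin.val_one', ← pow_eq_pow_mod _ h, pow_one]

theorem pow_val_sub_one {G : Type*} [GroupWithZero G] {N : ℕ} [NeZero N] {ω : G} (h : ω ^ N = 1)
    (n : Fin N) : ω ^ ((n - 1 : Fin N) : ℕ) = ω ^ (n : ℕ) * ω⁻¹ := by
  have hω : ω ≠ 0 := by
    rintro rfl
    simp [zero_pow (NeZero.ne N)] at h
  have := pow_val_add_one h (n - 1)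
  rw [sub_add_cancel] at this
  rw [this, mul_assoc, mul_inv_cancel₀ hω, mul_one]

/-- If `M` is intertwined with a block diagonal matrix by the Kronecker product of an invertible
matrix and the identity, then its determinant is the product of those of the blocks. -/
theorem det_eq_prod_det_of_mul_kronecker {ι κ K : Type*} [Fintype ι] [DecidableEq ι] [Fintype κ]
    [DecidableEq κ] [Field K] {V : Matrix ι ι K} (hV : V.det ≠ 0)
    {M : Matrix (ι × κ) (ι × κ) K} {Q : ι → Matrix κ κ K}
    (h : ∀ n i k j, (M *ᵥ fun p => V p.1 k * (1 : Matrix κ κ K) p.2 j) (n, i) = V n k * Q k i j) :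
    M.det = ∏ k, (Q k).det := by
  have hP : (kroneckerMap (· * ·) V (1 : Matrix κ κ K)).det ≠ 0 := by
    have := Matrix.det_kronecker V (1 : Matrix κ κ K)
    rw [this, det_one, one_pow, mul_one]
    exact pow_ne_zero _ hV
  have key : M * kroneckerMap (· * ·) V (1 : Matrix κ κ K) =
      kroneckerMap (· * ·) V (1 : Matrix κ κ K) *
        (blockDiagonal Q).submatrix (Equiv.prodComm ι κ) (Equiv.prodComm ι κ) := by
    ext ⟨n, i⟩ ⟨k, j⟩
    refine (h n i k j).trans ?_
    simp [Matrix.mul_apply, Fintype.sum_prod_type, blockDiagonal_apply, Matrix.one_apply]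
  have hdet := congrArg Matrix.det key
  rw [det_mul, det_mul, mul_comm, det_submatrix_equiv_self, det_blockDiagonal] at hdet
  exact mul_left_cancel₀ hP hdet


/-- the characteristic polynomial of the coefficient matrix `A` of
the linearised periodic car-following system factorises over ℂ as the product
over `k = 0, …, N-1` of the wave-angle quadratics with `ω = e^{2πi/N}`; in
particular `λ` is an eigenvalue of `A` iff it solves the characteristic
equation for some `k`. -/
theorem statement5 (N : ℕ) [NeZero N] (hN : 2 < N) (γ β α T : ℝ)
    (hγ : 0 < γ) (hβ : 0 ≤ β) (hα : 0 ≤ α) (hT : 0 < T)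
    (A : Matrix (Fin N × Fin 2) (Fin N × Fin 2) ℝ)
    (hA : ∀ (z : Fin N × Fin 2 → ℝ) (n : Fin N),
      A.mulVec z (n, 0) = z (n, 1) ∧
      A.mulVec z (n, 1)
        = γ * ((z (n + 1, 0) - z (n, 0)) / T - z (n, 1))
          + β * (z (n + 1, 1) - z (n, 1))
          + α * (z (n + 1, 0) - 2 * z (n, 0) + z (n - 1, 0)))
    (ω : ℂ) (hω : ω = Complex.exp (2 * Real.pi * Complex.I / N)) :
    (∀ lam : ℂ,
      (lam • (1 : Matrix (Fin N × Fin 2) (Fin N × Fin 2) ℂ)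
          - A.map (fun x : ℝ => (x : ℂ))).det
        = ∏ k : Fin N,
            (lam ^ 2 + (γ : ℂ) * ((1 - ω ^ (k : ℕ)) / (T : ℂ) + lam)
              + (β : ℂ) * lam * (1 - ω ^ (k : ℕ))
              + (α : ℂ) * (2 - ω ^ (k : ℕ) - ω ^ (-(k : ℤ))))) ∧
    (∀ lam : ℂ,
      (∃ v : Fin N × Fin 2 → ℂ, v ≠ 0 ∧
          (A.map (fun x : ℝ => (x : ℂ))).mulVec v = lam • v) ↔
        ∃ k : Fin N,
          lam ^ 2 + (γ : ℂ) * ((1 - ω ^ (k : ℕ)) / (T : ℂ) + lam)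
            + (β : ℂ) * lam * (1 - ω ^ (k : ℕ))
            + (α : ℂ) * (2 - ω ^ (k : ℕ) - ω ^ (-(k : ℤ))) = 0) := by
  have hprim : IsPrimitiveRoot ω N := hω ▸ Complex.isPrimitiveRoot_exp N (NeZero.ne N)
  have hAc (z : Fin N × Fin 2 → ℂ) (n : Fin N) :
      (A.map (fun x : ℝ => (x : ℂ))).mulVec z (n, 0) = z (n, 1) ∧
      (A.map (fun x : ℝ => (x : ℂ))).mulVec z (n, 1)
        = γ * ((z (n + 1, 0) - z (n, 0)) / T - z (n, 1))
          + β * (z (n + 1, 1) - z (n, 1))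
          + α * (z (n + 1, 0) - 2 * z (n, 0) + z (n - 1, 0)) := by
    have h0 := re_im_map_ofReal_mulVec A z (n, 0)
    have h1 := re_im_map_ofReal_mulVec A z (n, 1)
    rw [(hA _ n).1, (hA _ n).1] at h0
    rw [(hA _ n).2, (hA _ n).2] at h1
    refine ⟨Complex.ext h0.1 h0.2, Complex.ext (h1.1.trans ?_) (h1.2.trans ?_)⟩ <;>
      simp [Complex.div_ofReal_re, Complex.div_ofReal_im]
  have hfactor (lam : ℂ) :
      (lam • (1 : Matrix (Fin N × Fin 2) (Fin N × Fin 2) ℂ)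
          - A.map (fun x : ℝ => (x : ℂ))).det
        = ∏ k : Fin N,
            (lam ^ 2 + (γ : ℂ) * ((1 - ω ^ (k : ℕ)) / (T : ℂ) + lam)
              + (β : ℂ) * lam * (1 - ω ^ (k : ℕ))
              + (α : ℂ) * (2 - ω ^ (k : ℕ) - ω ^ (-(k : ℤ)))) := by
    have hV : (vandermonde fun n : Fin N => ω ^ (n : ℕ)).det ≠ 0 :=
      det_vandermonde_ne_zero_iff.mpr fun i j hij =>
        Fin.ext (hprim.pow_inj i.isLt j.isLt hij)
    rw [det_eq_prod_det_of_mul_kronecker hV (Q := fun k : Fin N =>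
      !![lam, -1;
         γ * (1 - ω ^ (k : ℕ)) / T + α * (2 - ω ^ (k : ℕ) - ω ^ (-(k : ℤ))),
         lam + γ + β * (1 - ω ^ (k : ℕ))])]
    · refine Finset.prod_congr rfl fun k _ => ?_
      rw [det_fin_two_of]
      ring
    · intro n i k j
      rw [sub_mulVec, smul_mulVec, one_mulVec, Pi.sub_apply, Pi.smul_apply]
      fin_cases i
      · simp only [Fin.zero_eta, (hAc _ n).1]
        fin_cases j <;> simp [Matrix.one_apply, mul_comm]
      · simp only [Fin.mk_one, (hAc _ n).2, vandermonde_apply,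
          pow_val_add_one hprim.pow_eq_one, pow_val_sub_one hprim.pow_eq_one, mul_pow]
        fin_cases j <;> simp [Matrix.one_apply] <;> ring
  refine ⟨hfactor, fun lam => ?_⟩
  have hroot := hfactor lam ▸ (Finset.prod_eq_zero_iff (s := Finset.univ) (f := fun k : Fin N =>
    lam ^ 2 + (γ : ℂ) * ((1 - ω ^ (k : ℕ)) / (T : ℂ) + lam)
      + (β : ℂ) * lam * (1 - ω ^ (k : ℕ))
      + (α : ℂ) * (2 - ω ^ (k : ℕ) - ω ^ (-(k : ℤ)))))
  simp only [Finset.mem_univ, true_and] at hroot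
  rw [← hroot, ← exists_mulVec_eq_zero_iff]
  refine exists_congr fun v => and_congr_right fun _ => ?_
  rw [sub_mulVec, smul_mulVec, one_mulVec, sub_eq_zero, eq_comm]
end

section
/- Let μ, σ, ν, ρ ∈ ℝ. Both roots λ ∈ ℂ of the complex quadratic equation z² + (μ + iσ)z + (ν + iρ) = 0 satisfy Re(λ) < 0 if and only if μ > 0 and μ(νμ + ρσ) − ρ² > 0. -/
open Complex

/-- Every monic complex quadratic splits into linear factors. -/
lemma exists_monic_quadratic_eq_mul (b c : ℂ) :
    ∃ r s : ℂ, b = -(r + s) ∧ c = r * s ∧ ∀ z : ℂ, z ^ 2 + b * z + c = (z - r) * (z - s) := by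
  obtain ⟨d, hd⟩ := IsAlgClosed.exists_pow_nat_eq (b ^ 2 - 4 * c) (n := 2) two_pos
  refine ⟨(-b + d) / 2, (-b - d) / 2, by ring, ?_, fun z ↦ ?_⟩
  · linear_combination hd / 4
  · linear_combination hd / 4

/-- Routh–Hurwitz for complex quadratics: both roots of
`z² + (μ + iσ)z + (ν + iρ)` have strictly negative real part iff `μ > 0` and
`μ(νμ + ρσ) − ρ² > 0`. -/
theorem statement7 (μ σ ν ρ : ℝ) :
    (∀ lam : ℂ,
        lam ^ 2 + ((μ : ℂ) + (σ : ℂ) * Complex.I) * lam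
          + ((ν : ℂ) + (ρ : ℂ) * Complex.I) = 0 → lam.re < 0) ↔
      (0 < μ ∧ 0 < μ * (ν * μ + ρ * σ) - ρ ^ 2) := by
  obtain ⟨r, s, hsum, hprod, hfactor⟩ :=
    exists_monic_quadratic_eq_mul ((μ : ℂ) + (σ : ℂ) * I) ((ν : ℂ) + (ρ : ℂ) * I)
  have hμ : μ = -(r.re + s.re) := by simpa using congrArg re hsum
  have hσ : σ = -(r.im + s.im) := by simpa using congrArg im hsum
  have hν : ν = r.re * s.re - r.im * s.im := by simpa using congrArg re hprod
  have hρ : ρ = r.re * s.im + r.im * s.re := by simpa using congrArg im hprod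
  have hroots : (∀ z : ℂ, z ^ 2 + ((μ : ℂ) + (σ : ℂ) * I) * z + ((ν : ℂ) + (ρ : ℂ) * I) = 0 →
      z.re < 0) ↔ r.re < 0 ∧ s.re < 0 := by
    simp only [hfactor, mul_eq_zero, sub_eq_zero, or_imp, forall_and, forall_eq]
  have hdisc : μ * (ν * μ + ρ * σ) - ρ ^ 2 =
      r.re * s.re * ((r.re + s.re) ^ 2 + (r.im - s.im) ^ 2) := by
    rw [hμ, hσ, hν, hρ]; ring
  rw [hroots, hdisc, hμ]
  constructor
  · rintro ⟨hr, hs⟩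
    have hrs : 0 < (r.re + s.re) ^ 2 := sq_pos_of_neg (by linarith)
    exact ⟨by linarith, mul_pos (mul_pos_of_neg_of_neg hr hs) (by positivity)⟩
  · rintro ⟨hadd, hmul⟩
    rcases mul_pos_iff.mp (pos_of_mul_pos_left hmul (by positivity)) with ⟨hr, hs⟩ | h
    · linarith
    · exact h
end

section
/- Let γ > 0, β ≥ 0, α ≥ 0, T > 0 satisfy the stability condition γ/2 + β + Tα > 1/T. Then for every real c with −1 ≤ c < 1, one has (β(1−c)+γ)·[(β(1−c)+γ)(1−c)(γ/T + 2α) + (βγ/T)(1−c²)] − (γ/T)²(1−c²) > 0. Equivalently, for every θ ∈ (0, 2π), setting c = cos θ, the quantity (β(1−cos θ)+γ)[(β(1−cos θ)+γ)(1−cos θ)(γ/T + 2α) + (βγ/T)sin²θ] − (γ/T)² sin²θ is strictly positive. -/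
/-- The Routh–Hurwitz quantity in terms of `s = 1 / T` and `c = cos θ`. -/
theorem routh_hurwitz_pos {γ β α s c : ℝ} (hγ : 0 < γ) (hβ : 0 ≤ β) (hα : 0 ≤ α) (hs : 0 < s)
    (hstab : 2 * s ^ 2 < γ * s + 2 * α + 2 * β * s) (hc : -1 ≤ c) (hc' : c < 1) :
    0 < (β * (1 - c) + γ)
          * ((β * (1 - c) + γ) * (1 - c) * (γ * s + 2 * α) + (β * γ * s) * (1 - c ^ 2))
        - (γ * s) ^ 2 * (1 - c ^ 2) := by
  have hu : 0 < 1 - c := by linarith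
  have hv : 0 ≤ 1 + c := by linarith
  have hd : 0 < γ * s + 2 * α + 2 * β * s - 2 * s ^ 2 := by linarith
  have key : 0 < (1 - c) * (γ ^ 2 * (γ * s + 2 * α + 2 * β * s - 2 * s ^ 2)
      + β ^ 2 * (1 - c) ^ 2 * (γ * s + 2 * α) + β ^ 2 * γ * s * (1 - c) * (1 + c)
      + β * γ * (1 - c) * (γ * s + 4 * α) + γ ^ 2 * s ^ 2 * (1 - c)) := by
    positivity
  linear_combination key

/-- the Routh–Hurwitz determinant quantity of the linearised
car-following system is strictly positive under the stability condition
`γ/2 + β + Tα > 1/T`, both in terms of `c = cos θ ∈ [-1, 1)` and in terms of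
the wave angle `θ ∈ (0, 2π)`. -/
theorem statement8 (γ β α T : ℝ) (hγ : 0 < γ) (hβ : 0 ≤ β) (hα : 0 ≤ α) (hT : 0 < T)
    (hstab : γ / 2 + β + T * α > 1 / T) :
    (∀ c : ℝ, -1 ≤ c → c < 1 →
      (β * (1 - c) + γ)
          * ((β * (1 - c) + γ) * (1 - c) * (γ / T + 2 * α)
            + (β * γ / T) * (1 - c ^ 2))
        - (γ / T) ^ 2 * (1 - c ^ 2) > 0) ∧
    (∀ θ ∈ Set.Ioo (0 : ℝ) (2 * Real.pi),
      (β * (1 - Real.cos θ) + γ)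
          * ((β * (1 - Real.cos θ) + γ) * (1 - Real.cos θ) * (γ / T + 2 * α)
            + (β * γ / T) * (Real.sin θ) ^ 2)
        - (γ / T) ^ 2 * (Real.sin θ) ^ 2 > 0) := by
  have hs : 0 < T⁻¹ := inv_pos.mpr hT
  have hstab' : 2 * T⁻¹ ^ 2 < γ * T⁻¹ + 2 * α + 2 * β * T⁻¹ := by
    have h := mul_lt_mul_of_pos_right hstab hs
    have hTi : T * T⁻¹ = 1 := mul_inv_cancel₀ hT.ne'
    rw [one_div] at h
    linear_combination 2 * h + 2 * α * hTi
  have main : ∀ c : ℝ, -1 ≤ c → c < 1 →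
      (β * (1 - c) + γ)
          * ((β * (1 - c) + γ) * (1 - c) * (γ / T + 2 * α)
            + (β * γ / T) * (1 - c ^ 2))
        - (γ / T) ^ 2 * (1 - c ^ 2) > 0 := fun c hc hc' => by
    simpa only [div_eq_mul_inv] using routh_hurwitz_pos hγ hβ hα hs hstab' hc hc'
  refine ⟨main, fun θ hθ => ?_⟩
  have hne : Real.cos θ ≠ 1 := fun h =>
    hθ.1.ne' ((Real.cos_eq_one_iff_of_lt_of_lt (by linarith [hθ.1, Real.pi_pos]) hθ.2).mp h)
  rw [Real.sin_sq]
  exact main _ (Real.neg_one_le_cos θ) (lt_of_le_of_ne (Real.cos_le_one θ) hne)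
end

section
/- Let γ > 0, β ≥ 0 and α > 0. Then for every θ ∈ (0, 2π), every complex root λ of the equation λ² + γλ + βλ(1 − e^{iθ}) + α(2 − e^{iθ} − e^{−iθ}) = 0 satisfies Re(λ) < 0. -/
open Complex Real

/-- A monic complex quadratic whose linear coefficient has positive real part and whose constant
coefficient is a positive real has all its roots in the open left half-plane. -/
theorem re_neg_of_sq_add_mul_add_eq_zero {z w : ℂ} {k : ℝ} (hw : 0 < w.re) (hk : 0 < k)
    (h : z ^ 2 + w * z + k = 0) : z.re < 0 := by
  have hz : z ≠ 0 := by
    rintro rfl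
    simp [hk.ne'] at h
  have hre := congrArg Complex.re h
  have him := congrArg Complex.im h
  simp only [sq, Complex.add_re, Complex.add_im, Complex.mul_re, Complex.mul_im,
    Complex.ofReal_re, Complex.ofReal_im, Complex.zero_re, Complex.zero_im] at hre him
  have hn : 0 < Complex.normSq z := Complex.normSq_pos.mpr hz
  have key : z.re * (Complex.normSq z + k) = -(w.re * Complex.normSq z) := by
    rw [Complex.normSq_apply]
    linear_combination z.re * hre + z.im * him
  by_contra! hx
  have := mul_nonneg hx (add_pos hn hk).le
  have := mul_pos hw hn
  linarith

theorem cos_lt_one_of_mem_Ioo {θ : ℝ} (hθ : θ ∈ Set.Ioo (0 : ℝ) (2 * Real.pi)) :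
    Real.cos θ < 1 := by
  refine (Real.cos_le_one θ).lt_of_ne fun h => hθ.1.ne' ?_
  exact (Real.cos_eq_one_iff_of_lt_of_lt (by linarith [hθ.1, Real.pi_pos]) hθ.2).mp h

/-- with a constant optimal velocity function, for `γ > 0`, `β ≥ 0`
and `α > 0`, every root of the characteristic equation
`λ² + γλ + βλ(1 − e^{iθ}) + α(2 − e^{iθ} − e^{−iθ}) = 0` with θ ∈ (0, 2π) has
strictly negative real part. -/
theorem statement9 (γ β α : ℝ) (hγ : 0 < γ) (hβ : 0 ≤ β) (hα : 0 < α) :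
    ∀ θ ∈ Set.Ioo (0 : ℝ) (2 * Real.pi), ∀ lam : ℂ,
      lam ^ 2 + (γ : ℂ) * lam
        + (β : ℂ) * lam * (1 - Complex.exp (θ * Complex.I))
        + (α : ℂ) * (2 - Complex.exp (θ * Complex.I) - Complex.exp (-(θ * Complex.I))) = 0 →
      lam.re < 0 := by
  intro θ hθ lam h
  have hcos := cos_lt_one_of_mem_Ioo hθ
  refine re_neg_of_sq_add_mul_add_eq_zero (w := γ + β * (1 - Complex.exp (θ * Complex.I)))
    (k := α * (2 * (1 - Real.cos θ))) ?_ (by have := sub_pos.mpr hcos; positivity) ?_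
  · have := mul_nonneg hβ (sub_pos.mpr hcos).le
    simp only [Complex.add_re, Complex.re_ofReal_mul, Complex.sub_re, Complex.one_re,
      Complex.ofReal_re, Complex.exp_ofReal_mul_I_re]
    linarith
  · have hc := Complex.two_cos (θ : ℂ)
    rw [neg_mul] at hc
    push_cast
    linear_combination h - α * hc
end

section
/- Let N > 2 and γ > 0, β ≥ 0, α ≥ 0, T > 0 satisfy the stability condition γ/2 + β + Tα > 1/T, and let A ∈ ℝ^{2N×2N} be the coefficient matrix of the linearised periodic car-following system. If A is diagonalisable, then every solution S : [0,∞) → ℝ^{2N} of the linear system Ṡ(t) = A S(t) is bounded on [0, ∞): there exists a constant K (depending on S(0)) with ‖S(t)‖ ≤ K for all t ≥ 0. -/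
open Matrix

/-- Routh–Hurwitz criterion for a monic quadratic with complex coefficients. -/
lemma re_nonpos_of_quadratic_eq_zero {a b c d : ℝ} (ha : 0 < a) (hc : 0 ≤ c)
    (h : 0 ≤ a ^ 2 * c + a * b * d - d ^ 2) {z : ℂ}
    (hz : z ^ 2 + (⟨a, b⟩ : ℂ) * z + ⟨c, d⟩ = 0) : z.re ≤ 0 := by
  by_contra! hr
  have hre := congrArg Complex.re hz
  have him := congrArg Complex.im hz
  simp only [pow_two, Complex.add_re, Complex.add_im, Complex.mul_re, Complex.mul_im,
    Complex.zero_re, Complex.zero_im] at hre him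
  set r := z.re
  set s := z.im
  have key : (a ^ 2 * c + a * b * d - d ^ 2) + (4 * a * c + a ^ 3 + a * b ^ 2) * r
      + (4 * c + 5 * a ^ 2 + b ^ 2) * r ^ 2 + 8 * a * r ^ 3 + 4 * r ^ 4 = 0 := by
    linear_combination (2 * r + a) ^ 2 * hre
      + (s * (2 * r + a) - (b * r + d) + b * (2 * r + a)) * him
  have : 0 < 4 * r ^ 4 := by positivity
  have : 0 ≤ (4 * a * c + a ^ 3 + a * b ^ 2) * r := by positivity
  have : 0 ≤ (4 * c + 5 * a ^ 2 + b ^ 2) * r ^ 2 := by positivity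
  have : 0 ≤ 8 * a * r ^ 3 := by positivity
  linarith

/-- Under the stability condition, the roots of the car-following dispersion relation have
nonpositive real part for every symbol `w` in the closed unit disc. -/
lemma re_nonpos_of_dispersion {γ β α T : ℝ}
    (hγ : 0 < γ) (hβ : 0 ≤ β) (hα : 0 ≤ α) (hT : 0 < T)
    (hstab : γ / 2 + β + T * α > 1 / T) {w z : ℂ} (hw : ‖w‖ ≤ 1)
    (hz : z ^ 2 + (γ + β * (1 - w)) * z
      + (γ * (1 - w) / T + α * (2 - w - star w)) = 0) : z.re ≤ 0 := by
  obtain ⟨p, hp⟩ : ∃ p, p = 1 - w.re := ⟨_, rfl⟩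
  obtain ⟨q, hq⟩ : ∃ q, q = -w.im := ⟨_, rfl⟩
  have hpq : q ^ 2 ≤ 2 * p - p ^ 2 := by
    have h1 : w.re ^ 2 + w.im ^ 2 ≤ 1 := by
      have := Complex.sq_norm w
      rw [Complex.normSq_apply] at this
      nlinarith [norm_nonneg w]
    subst hp hq
    nlinarith
  have hp0 : 0 ≤ p := by nlinarith [sq_nonneg q, sq_nonneg p]
  refine re_nonpos_of_quadratic_eq_zero (a := γ + β * p) (b := β * q)
    (c := (γ / T + 2 * α) * p) (d := γ / T * q) (by positivity) (by positivity) ?_ ?_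
  · obtain ⟨τ, hτ⟩ : ∃ τ, τ = 1 / T := ⟨_, rfl⟩
    have hτ0 : 0 < τ := by rw [hτ]; positivity
    have hγτ : γ / T = γ * τ := by rw [hτ]; ring
    have hstab' : τ ^ 2 ≤ γ / 2 * τ + β * τ + α := by
      have hTτ : T * τ = 1 := by rw [hτ]; field_simp
      rw [← hτ] at hstab
      nlinarith
    rw [hγτ]
    have hfac : (γ + β * p) ^ 2 * ((γ * τ + 2 * α) * p) + (γ + β * p) * (β * q) * (γ * τ * q)
        - (γ * τ * q) ^ 2 = (γ + β * p) ^ 2 * ((γ * τ + 2 * α) * p)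
          + q ^ 2 * ((γ + β * p) * β * (γ * τ) - (γ * τ) ^ 2) := by ring
    rw [hfac]
    rcases le_total 0 ((γ + β * p) * β * (γ * τ) - (γ * τ) ^ 2) with h | h
    · positivity
    · have hle : q ^ 2 ≤ 2 * p := by nlinarith
      have h1 := mul_le_mul_of_nonpos_right hle h
      have h2 : γ ^ 2 * ((γ * τ + 2 * α) * p) ≤ (γ + β * p) ^ 2 * ((γ * τ + 2 * α) * p) := by
        gcongr
        nlinarith [mul_nonneg hβ hp0]
      have h3 : 0 ≤ 2 * p * (β * p * β * (γ * τ)) := by positivity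
      have h4 : 0 ≤ 2 * γ ^ 2 * p * (γ / 2 * τ + β * τ + α - τ ^ 2) :=
        mul_nonneg (by positivity) (by linarith)
      nlinarith
  · rw [← hz]
    subst hp hq
    apply Complex.ext
    · simp [Complex.div_re, Complex.normSq_apply]
      field_simp
      ring
    · simp [Complex.div_im, Complex.normSq_apply]
      field_simp

/-- The correlation of a periodic sequence with its shift is dominated by its energy. -/
lemma norm_sum_shift_mul_star_le {N : ℕ} [NeZero N] (x : Fin N → ℂ) :
    ‖∑ n, x (n + 1) * star (x n)‖ ≤ ∑ n, ‖x n‖ ^ 2 := by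
  have hshift : ∑ n, ‖x (n + 1)‖ ^ 2 = ∑ n, ‖x n‖ ^ 2 :=
    Equiv.sum_comp (Equiv.addRight (1 : Fin N)) fun n => ‖x n‖ ^ 2
  calc ‖∑ n, x (n + 1) * star (x n)‖ ≤ ∑ n, ‖x (n + 1) * star (x n)‖ := norm_sum_le _ _
    _ ≤ ∑ n, (‖x (n + 1)‖ ^ 2 + ‖x n‖ ^ 2) / 2 := by
        gcongr with n
        rw [norm_mul, norm_star]
        nlinarith [sq_nonneg (‖x (n + 1)‖ - ‖x n‖)]
    _ = ∑ n, ‖x n‖ ^ 2 := by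
        rw [← Finset.sum_div, Finset.sum_add_distrib, hshift]
        ring

/-- Under the stability condition, the growth rate of every nonzero periodic mode of the
car-following system has nonpositive real part. -/
lemma re_nonpos_of_periodic_mode {N : ℕ} [NeZero N] {γ β α T : ℝ}
    (hγ : 0 < γ) (hβ : 0 ≤ β) (hα : 0 ≤ α) (hT : 0 < T)
    (hstab : γ / 2 + β + T * α > 1 / T) {z : ℂ} {x : Fin N → ℂ} (hx : x ≠ 0)
    (h : ∀ n, z * (z * x n) = γ * ((x (n + 1) - x n) / T - z * x n)
      + β * (z * x (n + 1) - z * x n) + α * (x (n + 1) - 2 * x n + x (n - 1))) :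
    z.re ≤ 0 := by
  set E : ℝ := ∑ n, ‖x n‖ ^ 2 with hE
  set W : ℂ := ∑ n, x (n + 1) * star (x n) with hW
  have hE0 : 0 < E := by
    obtain ⟨n, hn⟩ := Function.ne_iff.mp hx
    exact Finset.sum_pos' (fun _ _ => by positivity)
      ⟨n, Finset.mem_univ n, pow_pos (norm_pos_iff.mpr hn) 2⟩
  have hEC : (E : ℂ) ≠ 0 := by exact_mod_cast hE0.ne'
  have hEsum : ∑ n, x n * star (x n) = (E : ℂ) := by
    rw [hE]
    push_cast
    exact Finset.sum_congr rfl fun n _ => Complex.mul_conj' (x n)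
  have hWstar : ∑ n, x (n - 1) * star (x n) = star W := by
    rw [hW, star_sum, ← Equiv.sum_comp (Equiv.addRight (1 : Fin N))]
    refine Finset.sum_congr rfl fun n _ => ?_
    simp [mul_comm]
  have hquad : z * z * E = γ * ((W - E) / T - z * E) + β * (z * W - z * E)
      + α * (W - 2 * E + star W) := by
    rw [← hWstar, ← hEsum, hW]
    simp only [Finset.mul_sum, Finset.sum_div, ← Finset.sum_sub_distrib,
      ← Finset.sum_add_distrib]
    refine Finset.sum_congr rfl fun n _ => ?_
    linear_combination star (x n) * h n
  refine re_nonpos_of_dispersion hγ hβ hα hT hstab (w := W / E) ?_ ?_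
  · rw [norm_div, Complex.norm_real, Real.norm_of_nonneg hE0.le]
    exact div_le_one_of_le₀ (norm_sum_shift_mul_star_le x) hE0.le
  · have hTC : (T : ℂ) ≠ 0 := by exact_mod_cast hT.ne'
    have hs : star (W / E) = star W / E := by simp
    rw [hs]
    field_simp at hquad ⊢
    linear_combination hquad

lemma map_ofReal_mulVec {m n : Type*} [Fintype n] (A : Matrix m n ℝ) (z : n → ℂ) (i : m) :
    (A.map (fun x : ℝ => (x : ℂ)) *ᵥ z) i
      = ⟨(A *ᵥ fun j => (z j).re) i, (A *ᵥ fun j => (z j).im) i⟩ := by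
  apply Complex.ext <;> simp [mulVec, dotProduct]

/-- A scalar solution of `f' = c f` with `re c ≤ 0` does not grow. -/
lemma norm_le_of_hasDerivAt_mul {f : ℝ → ℂ} {c : ℂ} (hc : c.re ≤ 0)
    (hf : ∀ t, 0 ≤ t → HasDerivAt f (c * f t) t) {t : ℝ} (ht : 0 ≤ t) :
    ‖f t‖ ≤ ‖f 0‖ := by
  have hd : ∀ s : ℝ, 0 ≤ s → HasDerivAt (fun s : ℝ => Complex.exp (-(c * s)) * f s) 0 s := by
    intro s hs
    have h1 : HasDerivAt (fun s : ℝ => -(c * (s : ℂ))) (-c) s := by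
      simpa using ((hasDerivAt_id s).ofReal_comp.const_mul c).fun_neg
    refine (h1.cexp.fun_mul (hf s hs)).congr_deriv ?_
    ring
  have hconst := constant_of_has_deriv_right_zero
    (f := fun s : ℝ => Complex.exp (-(c * s)) * f s) (a := 0) (b := t)
    (fun s hs => (hd s hs.1).continuousAt.continuousWithinAt)
    (fun s hs => (hd s hs.1).hasDerivWithinAt) t ⟨ht, le_rfl⟩
  have hft : f t = Complex.exp (c * t) * f 0 := by
    simp only [Complex.ofReal_zero, mul_zero, neg_zero, Complex.exp_zero, one_mul] at hconst
    rw [← hconst, ← mul_assoc, ← Complex.exp_add]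
    simp
  rw [hft, norm_mul, Complex.norm_exp]
  have : (c * t).re ≤ 0 := by simpa using mul_nonpos_of_nonpos_of_nonneg hc ht
  exact mul_le_of_le_one_left (norm_nonneg _) (Real.exp_le_one_iff.mpr this)

/-- Solutions of a diagonalisable real linear system whose (complex) eigenvalues all have
nonpositive real part are bounded on `[0, ∞)`. -/
lemma bounded_of_diagonalisable {ι : Type*} [Fintype ι] [DecidableEq ι] {A : Matrix ι ι ℝ}
    (hdiag : ∃ P : Matrix ι ι ℂ,
      IsUnit P.det ∧ (P⁻¹ * A.map (fun x : ℝ => (x : ℂ)) * P).IsDiag)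
    (hev : ∀ (z : ℂ) (v : ι → ℂ), v ≠ 0 →
      A.map (fun x : ℝ => (x : ℂ)) *ᵥ v = z • v → z.re ≤ 0)
    {S : ℝ → ι → ℝ}
    (hS : ∀ (i : ι) (t : ℝ), 0 ≤ t → HasDerivAt (fun t => S t i) ((A *ᵥ S t) i) t) :
    ∃ K : ℝ, ∀ t : ℝ, 0 ≤ t → ‖S t‖ ≤ K := by
  obtain ⟨P, hP, hD⟩ := hdiag
  obtain ⟨d, hd⟩ : ∃ d, diagonal d = P⁻¹ * A.map (fun x : ℝ => (x : ℂ)) * P :=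
    ⟨_, hD.diagonal_diag⟩
  set B := A.map (fun x : ℝ => (x : ℂ)) with hB
  have hre : ∀ j, (d j).re ≤ 0 := by
    intro j
    refine hev (d j) (P *ᵥ Pi.single j 1) ?_ ?_
    · intro h0
      have := congrArg (P⁻¹ *ᵥ ·) h0
      simp only [mulVec_mulVec, nonsing_inv_mul P hP, one_mulVec, mulVec_zero] at this
      simpa using congrFun this j
    · have hBP : B * P = P * diagonal d := by
        rw [hd, mul_assoc, mul_nonsing_inv_cancel_left P _ hP]
      rw [mulVec_mulVec, hBP, ← mulVec_mulVec, ← mulVec_smul]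
      congr 1
      ext i
      rcases eq_or_ne i j with rfl | hij
      · simp [mulVec_diagonal]
      · simp [mulVec_diagonal, hij]
  set Z : ℝ → ι → ℂ := fun t => P⁻¹ *ᵥ fun i => (S t i : ℂ) with hZ
  have hZd : ∀ j t, 0 ≤ t → HasDerivAt (fun t => Z t j) (d j * Z t j) t := by
    intro j t ht
    have h1 : d j * Z t j = (P⁻¹ *ᵥ fun i => (((A *ᵥ S t) i : ℝ) : ℂ)) j := by
      have hAS : (fun i => (((A *ᵥ S t) i : ℝ) : ℂ)) = B *ᵥ fun i => (S t i : ℂ) := by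
        ext i
        rw [map_ofReal_mulVec]
        apply Complex.ext <;> simp [mulVec, dotProduct]
      have hPB : diagonal d * P⁻¹ = P⁻¹ * B := by
        rw [hd, mul_nonsing_inv_cancel_right P _ hP]
      rw [hAS, mulVec_mulVec, ← hPB, ← mulVec_mulVec, mulVec_diagonal]
    rw [h1]
    exact HasDerivAt.fun_sum fun i _ => (hS i t ht).ofReal_comp.const_mul _
  refine ⟨∑ i, ∑ j, ‖P i j‖ * ‖Z 0 j‖, fun t ht => ?_⟩
  refine (pi_norm_le_iff_of_nonneg (by positivity)).mpr fun i => ?_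
  have hSi : (S t i : ℂ) = (P *ᵥ Z t) i := by
    simp [hZ, mulVec_mulVec, mul_nonsing_inv P hP]
  calc ‖S t i‖ = ‖(P *ᵥ Z t) i‖ := by rw [← hSi, Complex.norm_real]
    _ ≤ ∑ j, ‖P i j * Z t j‖ := norm_sum_le _ _
    _ ≤ ∑ j, ‖P i j‖ * ‖Z 0 j‖ := by
        gcongr with j
        rw [norm_mul]
        gcongr
        exact norm_le_of_hasDerivAt_mul (hre j) (hZd j) ht
    _ ≤ ∑ i, ∑ j, ‖P i j‖ * ‖Z 0 j‖ :=
        Finset.single_le_sum (f := fun i => ∑ j, ‖P i j‖ * ‖Z 0 j‖)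
          (fun _ _ => by positivity) (Finset.mem_univ i)

/-- under the stability condition `γ/2 + β + Tα > 1/T`, if the
coefficient matrix `A` of the linearised periodic car-following system is
diagonalisable (over ℂ), then every solution of `Ṡ = A S` on `[0, ∞)` is
bounded on `[0, ∞)`. -/
theorem statement17 (N : ℕ) [NeZero N] (hN : 2 < N) (γ β α T : ℝ)
    (hγ : 0 < γ) (hβ : 0 ≤ β) (hα : 0 ≤ α) (hT : 0 < T)
    (hstab : γ / 2 + β + T * α > 1 / T)
    (A : Matrix (Fin N × Fin 2) (Fin N × Fin 2) ℝ)
    (hA : ∀ (z : Fin N × Fin 2 → ℝ) (n : Fin N),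
      A.mulVec z (n, 0) = z (n, 1) ∧
      A.mulVec z (n, 1)
        = γ * ((z (n + 1, 0) - z (n, 0)) / T - z (n, 1))
          + β * (z (n + 1, 1) - z (n, 1))
          + α * (z (n + 1, 0) - 2 * z (n, 0) + z (n - 1, 0)))
    (hdiag : ∃ P : Matrix (Fin N × Fin 2) (Fin N × Fin 2) ℂ,
      IsUnit P.det ∧ (P⁻¹ * A.map (fun x : ℝ => (x : ℂ)) * P).IsDiag)
    (S : ℝ → Fin N × Fin 2 → ℝ)
    (hS : ∀ (i : Fin N × Fin 2) (t : ℝ), 0 ≤ t →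
      HasDerivAt (fun t => S t i) (A.mulVec (S t) i) t) :
    ∃ K : ℝ, ∀ t : ℝ, 0 ≤ t → ‖S t‖ ≤ K := by
  refine bounded_of_diagonalisable hdiag (fun z v hv hz => ?_) hS
  have hy : ∀ n, v (n, 1) = z * v (n, 0) := by
    intro n
    have h := congrFun hz (n, 0)
    rw [map_ofReal_mulVec, (hA _ n).1, (hA _ n).1] at h
    simpa using h
  refine re_nonpos_of_periodic_mode hγ hβ hα hT hstab (x := fun n => v (n, 0)) ?_ fun n => ?_
  · intro h0
    refine hv (funext fun ⟨n, k⟩ => ?_)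
    have hn : v (n, 0) = 0 := congrFun h0 n
    fin_cases k
    · exact hn
    · simpa [hn] using hy n
  · have h := congrFun hz (n, 1)
    rw [map_ofReal_mulVec, (hA _ n).2, (hA _ n).2] at h
    simp only [Pi.smul_apply, smul_eq_mul] at h
    simp only [← hy]
    rw [← h]
    apply Complex.ext <;> simp
end

section
/- Let N > 2 and γ > 0, β ≥ 0, α ≥ 0, T > 0 satisfy the stability condition γ/2 + β + Tα > 1/T, and let A ∈ ℝ^{2N×2N} be the coefficient matrix of the linearised periodic car-following system. Then every eigenvalue λ of A with λ ≠ 0 satisfies Re(λ) < 0; consequently the spectral bound ā = min{−Re(λ) : λ eigenvalue of A, λ ≠ 0} is strictly positive. -/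
open Matrix

/-- A complex form of the Hurwitz criterion for the roots of a monic quadratic. -/
lemma re_neg_of_quadratic {a b c d : ℝ} {lam : ℂ} (ha : 0 < a) (hc : 0 ≤ c)
    (h : 0 < a ^ 2 * c + a * b * d - d ^ 2)
    (hlam : lam ^ 2 + (⟨a, b⟩ : ℂ) * lam + ⟨c, d⟩ = 0) : lam.re < 0 := by
  obtain ⟨u, w⟩ := lam
  have hre := congrArg Complex.re hlam
  have him := congrArg Complex.im hlam
  simp only [pow_two, Complex.add_re, Complex.mul_re, Complex.add_im, Complex.mul_im,
    Complex.zero_re, Complex.zero_im] at hre him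
  show u < 0
  by_contra! hu
  have key : (u ^ 2 + a * u) * (2 * u + a) ^ 2 + c * (4 * u ^ 2 + 4 * a * u)
      + b ^ 2 * u ^ 2 + b ^ 2 * a * u + (a ^ 2 * c + a * b * d - d ^ 2) = 0 := by
    linear_combination (2 * u + a) ^ 2 * hre
      + (w * (2 * u + a) - (b * u + d) + b * (2 * u + a)) * him
  have : 0 ≤ (u ^ 2 + a * u) * (2 * u + a) ^ 2 + c * (4 * u ^ 2 + 4 * a * u)
      + b ^ 2 * u ^ 2 + b ^ 2 * a * u := by positivity
  linarith

lemma hurwitz_pos {γ β m k c t : ℝ} (hγ : 0 < γ) (hβ : 0 ≤ β) (hm : 0 ≤ m)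
    (hk : k < γ / 2 + β + m) (hc : 0 < c) (ht : 0 ≤ t) (htc : t ≤ c * (2 - c)) :
    0 < (γ + β * c) ^ 2 * (γ + 2 * m) * c + t * γ * ((γ + β * c) * β - γ * k) := by
  have h1 : 0 ≤ t * γ ^ 2 * (γ / 2 + β + m - k) :=
    mul_nonneg (by positivity) (by linarith)
  have h2 : 0 ≤ γ ^ 2 * (γ + 2 * m) * (c * (2 - c) - t) :=
    mul_nonneg (by positivity) (by linarith)
  have h3 : 0 ≤ t * γ * β ^ 2 * c := by positivity
  have h4 : 0 < c ^ 2 * γ ^ 2 * (γ + 2 * m) := by positivity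
  have h5 : 0 ≤ (2 * γ * β * c + β ^ 2 * c ^ 2) * (γ + 2 * m) * c := by positivity
  linarith

/-- The characteristic equation, with the eigenvalue `w` of the shift replaced by any point of the
closed unit disc, has nonzero roots only in the open left half-plane. -/
lemma re_neg_of_characteristic_eq {γ β α T : ℝ} (hγ : 0 < γ) (hβ : 0 ≤ β) (hα : 0 ≤ α)
    (hT : 0 < T) (hstab : γ / 2 + β + T * α > 1 / T) {w lam : ℂ} (hw : ‖w‖ ≤ 1)
    (hlam : lam ≠ 0)
    (h : lam ^ 2 = γ * ((w - 1) / T - lam) + β * (lam * (w - 1)) + α * (2 * (w.re - 1))) :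
    lam.re < 0 := by
  have hw2 : w.re ^ 2 + w.im ^ 2 ≤ 1 := by
    have h1 : w.re * w.re + w.im * w.im ≤ 1 := by
      rw [← Complex.normSq_apply, Complex.normSq_eq_norm_sq]
      exact pow_le_one₀ (norm_nonneg w) hw
    linarith
  have hTne : T ≠ 0 := hT.ne'
  have hwre : w.re ≤ 1 := by nlinarith [sq_nonneg w.im]
  rcases hwre.eq_or_lt with h1 | h1
  · have hw1 : w = 1 := by
      apply Complex.ext
      · simpa using h1
      · have : w.im ^ 2 = 0 := le_antisymm (by rw [h1] at hw2; linarith) (sq_nonneg _)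
        simpa using this
    have h0 : lam * (lam + γ) = 0 := by
      rw [hw1] at h
      simp only [Complex.one_re, Complex.ofReal_one, sub_self] at h
      linear_combination h
    have h2 : lam = -(γ : ℂ) := by
      linear_combination (mul_eq_zero.mp h0).resolve_left hlam
    rw [h2]
    simpa using hγ
  · have hpos := hurwitz_pos (c := 1 - w.re) (t := w.im ^ 2) hγ hβ
      (mul_nonneg hT.le hα) hstab (by linarith) (sq_nonneg _) (by linarith)
    have hc : 0 < 1 - w.re := by linarith
    refine re_neg_of_quadratic (a := γ + β * (1 - w.re)) (b := -β * w.im)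
      (c := (γ / T + 2 * α) * (1 - w.re)) (d := -γ * w.im / T) (by positivity) (by positivity) ?_ ?_
    · refine (div_pos hpos hT).trans_eq ?_
      field_simp
      ring
    · have e1 : (⟨γ + β * (1 - w.re), -β * w.im⟩ : ℂ) = γ + β * (1 - w) := by
        apply Complex.ext <;> simp
      have e2 : (⟨(γ / T + 2 * α) * (1 - w.re), -γ * w.im / T⟩ : ℂ)
          = γ * (1 - w) / T + 2 * α * (1 - w.re) := by
        apply Complex.ext
        · simp [Complex.div_ofReal_re]
          ring
        · simp [Complex.div_ofReal_im]
      rw [e1, e2]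
      linear_combination h

lemma re_map_ofReal_mulVec {ι : Type*} [Fintype ι] (A : Matrix ι ι ℝ) (v : ι → ℂ) (i : ι) :
    ((A.map (fun x : ℝ => (x : ℂ))).mulVec v i).re = A.mulVec (fun j => (v j).re) i := by
  simp [Matrix.mulVec, dotProduct]

lemma im_map_ofReal_mulVec {ι : Type*} [Fintype ι] (A : Matrix ι ι ℝ) (v : ι → ℂ) (i : ι) :
    ((A.map (fun x : ℝ => (x : ℂ))).mulVec v i).im = A.mulVec (fun j => (v j).im) i := by
  simp [Matrix.mulVec, dotProduct]

lemma norm_sum_conj_mul_shift_le {N : ℕ} [NeZero N] (x : Fin N → ℂ) :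
    ‖∑ n, starRingEnd ℂ (x n) * x (n + 1)‖ ≤ ∑ n, ‖x n‖ ^ 2 := by
  have hshift : ∑ n, ‖x (n + 1)‖ ^ 2 = ∑ n, ‖x n‖ ^ 2 :=
    Equiv.sum_comp (Equiv.addRight (1 : Fin N)) (fun n => ‖x n‖ ^ 2)
  calc ‖∑ n, starRingEnd ℂ (x n) * x (n + 1)‖
      ≤ ∑ n, (‖x n‖ ^ 2 + ‖x (n + 1)‖ ^ 2) / 2 := by
        refine norm_sum_le_of_le _ fun n _ => ?_
        rw [norm_mul, RCLike.norm_conj]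
        linarith [two_mul_le_add_sq ‖x n‖ ‖x (n + 1)‖]
    _ = ∑ n, ‖x n‖ ^ 2 := by
        rw [← Finset.sum_div, Finset.sum_add_distrib, hshift]
        ring

lemma sum_conj_mul_shift_back {N : ℕ} [NeZero N] (x : Fin N → ℂ) :
    ∑ n, starRingEnd ℂ (x n) * x (n - 1)
      = starRingEnd ℂ (∑ n, starRingEnd ℂ (x n) * x (n + 1)) := by
  rw [map_sum, ← Equiv.sum_comp (Equiv.addRight (1 : Fin N))]
  refine Finset.sum_congr rfl fun n _ => ?_
  simp [mul_comm]

/-- A nonzero solution of the recurrence satisfied by the positions of an eigenvector gives a root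
of the characteristic equation at the Rayleigh quotient `w` of the shift. -/
lemma exists_characteristic_eq {N : ℕ} [NeZero N] {γ β α T : ℝ} {x : Fin N → ℂ} (hx : x ≠ 0)
    {lam : ℂ}
    (h : ∀ n, lam ^ 2 * x n = γ * ((x (n + 1) - x n) / T - lam * x n)
      + β * (lam * x (n + 1) - lam * x n) + α * (x (n + 1) - 2 * x n + x (n - 1))) :
    ∃ w : ℂ, ‖w‖ ≤ 1 ∧
      lam ^ 2 = γ * ((w - 1) / T - lam) + β * (lam * (w - 1)) + α * (2 * (w.re - 1)) := by
  set P : ℝ := ∑ n, ‖x n‖ ^ 2 with hP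
  set W : ℂ := ∑ n, starRingEnd ℂ (x n) * x (n + 1) with hW
  have hPpos : 0 < P := by
    obtain ⟨n, hn⟩ := Function.ne_iff.mp hx
    exact Finset.sum_pos' (fun _ _ => sq_nonneg _)
      ⟨n, Finset.mem_univ n, pow_pos (norm_pos_iff.mpr hn) 2⟩
  have hPc : (P : ℂ) ≠ 0 := by exact_mod_cast hPpos.ne'
  have hself : ∑ n, starRingEnd ℂ (x n) * x n = P := by
    simp [hP, Complex.conj_mul']
  have hsum : lam ^ 2 * P = γ * ((W - P) / T - lam * P) + β * (lam * W - lam * P)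
      + α * (W - 2 * P + starRingEnd ℂ W) := by
    rw [← sum_conj_mul_shift_back x, ← hself, hW]
    simp only [Finset.mul_sum, ← Finset.sum_sub_distrib, Finset.sum_div, ← Finset.sum_add_distrib]
    refine Finset.sum_congr rfl fun n _ => ?_
    linear_combination starRingEnd ℂ (x n) * h n
  refine ⟨W / P, ?_, ?_⟩
  · rw [norm_div, Complex.norm_real, Real.norm_of_nonneg hPpos.le]
    exact div_le_one_of_le₀ (norm_sum_conj_mul_shift_le x) hPpos.le
  · have hre : 2 * (((W / P).re : ℝ) : ℂ) = (W + starRingEnd ℂ W) / P := by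
      rw [Complex.add_conj, Complex.div_ofReal_re]
      push_cast
      ring
    have hone : (P : ℂ) * (P : ℂ)⁻¹ = 1 := mul_inv_cancel₀ hPc
    linear_combination (P : ℂ)⁻¹ * hsum - α * hre
      + (-lam ^ 2 - γ / T - γ * lam - β * lam - 2 * α) * hone

lemma finite_setOf_mulVec_eq_smul {ι : Type*} [Fintype ι] (M : Matrix ι ι ℂ) :
    {lam : ℂ | ∃ v : ι → ℂ, v ≠ 0 ∧ M.mulVec v = lam • v}.Finite := by
  classical
  refine (Module.End.finite_hasEigenvalue (Matrix.toLin' M)).subset ?_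
  rintro lam ⟨v, hv, h⟩
  exact Module.End.hasEigenvalue_of_hasEigenvector
    (Module.End.hasEigenvector_iff.mpr
      ⟨Module.End.mem_eigenspace_iff.mpr (by simpa using h), hv⟩)

/-- A positive function on a finite set is bounded below by a positive constant. -/
lemma Set.Finite.exists_pos_forall_le {X : Type*} {s : Set X} (hs : s.Finite) {f : X → ℝ}
    (hf : ∀ x ∈ s, 0 < f x) : ∃ a, 0 < a ∧ ∀ x ∈ s, a ≤ f x := by
  rcases s.eq_empty_or_nonempty with rfl | hne
  · exact ⟨1, one_pos, by simp⟩
  · obtain ⟨x, hx, hmin⟩ := hs.exists_minimalFor f s hne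
    exact ⟨f x, hf x hx, fun y hy => (le_total (f x) (f y)).elim id (hmin hy)⟩

/-- under the stability condition `γ/2 + β + Tα > 1/T`, every
nonzero eigenvalue of the coefficient matrix `A` of the linearised periodic
car-following system has strictly negative real part; consequently the
spectral bound `ā = min {-Re(λ) : λ eigenvalue of A, λ ≠ 0}` is strictly
positive. -/
theorem statement18 (N : ℕ) [NeZero N] (hN : 2 < N) (γ β α T : ℝ)
    (hγ : 0 < γ) (hβ : 0 ≤ β) (hα : 0 ≤ α) (hT : 0 < T)
    (hstab : γ / 2 + β + T * α > 1 / T)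
    (A : Matrix (Fin N × Fin 2) (Fin N × Fin 2) ℝ)
    (hA : ∀ (z : Fin N × Fin 2 → ℝ) (n : Fin N),
      A.mulVec z (n, 0) = z (n, 1) ∧
      A.mulVec z (n, 1)
        = γ * ((z (n + 1, 0) - z (n, 0)) / T - z (n, 1))
          + β * (z (n + 1, 1) - z (n, 1))
          + α * (z (n + 1, 0) - 2 * z (n, 0) + z (n - 1, 0))) :
    (∀ (lam : ℂ) (v : Fin N × Fin 2 → ℂ), v ≠ 0 →
      (A.map (fun x : ℝ => (x : ℂ))).mulVec v = lam • v → lam ≠ 0 → lam.re < 0) ∧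
    (∃ abar : ℝ, 0 < abar ∧
      ∀ (lam : ℂ), lam ≠ 0 →
        (∃ v : Fin N × Fin 2 → ℂ, v ≠ 0 ∧
          (A.map (fun x : ℝ => (x : ℂ))).mulVec v = lam • v) →
        abar ≤ -lam.re) := by
  have hneg : ∀ (lam : ℂ) (v : Fin N × Fin 2 → ℂ), v ≠ 0 →
      (A.map (fun x : ℝ => (x : ℂ))).mulVec v = lam • v → lam ≠ 0 → lam.re < 0 := by
    intro lam v hv hAv hlam
    have hvel : ∀ n, lam * v (n, 0) = v (n, 1) := by
      intro n
      rw [← smul_eq_mul, ← Pi.smul_apply, ← hAv]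
      apply Complex.ext
      · rw [re_map_ofReal_mulVec, (hA _ n).1]
      · rw [im_map_ofReal_mulVec, (hA _ n).1]
    have hacc : ∀ n, lam * v (n, 1) = γ * ((v (n + 1, 0) - v (n, 0)) / T - v (n, 1))
        + β * (v (n + 1, 1) - v (n, 1))
        + α * (v (n + 1, 0) - 2 * v (n, 0) + v (n - 1, 0)) := by
      intro n
      rw [← smul_eq_mul, ← Pi.smul_apply, ← hAv]
      apply Complex.ext
      · rw [re_map_ofReal_mulVec, (hA _ n).2]
        simp [Complex.div_ofReal_re]
      · rw [im_map_ofReal_mulVec, (hA _ n).2]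
        simp [Complex.div_ofReal_im]
    have hx : (fun n => v (n, 0)) ≠ 0 := by
      intro h0
      have hpos : ∀ n, v (n, 0) = 0 := congrFun h0
      apply hv
      ext ⟨n, i⟩
      fin_cases i
      · exact hpos n
      · simpa [hpos n] using (hvel n).symm
    obtain ⟨w, hw, hchar⟩ := exists_characteristic_eq (γ := γ) (β := β) (α := α) (T := T)
      (lam := lam) hx fun n => by
        rw [hvel n, hvel (n + 1), ← hacc n, ← hvel n]
        ring
    exact re_neg_of_characteristic_eq hγ hβ hα hT hstab hw hlam hchar
  refine ⟨hneg, ?_⟩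
  obtain ⟨abar, hpos, hle⟩ := Set.Finite.exists_pos_forall_le
    (s := {lam : ℂ | ∃ v : Fin N × Fin 2 → ℂ, v ≠ 0 ∧
      (A.map (fun x : ℝ => (x : ℂ))).mulVec v = lam • v} ∩ {lam | lam ≠ 0})
    (f := fun lam => -lam.re) ((finite_setOf_mulVec_eq_smul _).inter_of_left _)
    (by
      rintro lam ⟨⟨v, hv, hAv⟩, hlam⟩
      exact neg_pos.mpr (hneg lam v hv hAv hlam))
  exact ⟨abar, hpos, fun lam hlam hex => hle lam ⟨hex, hlam⟩⟩
end
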